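/- arXiv:2105.05536 — 11 statements merged into one kernel-verified Lean document; each statement's English description precedes it below -/
import Mathlib

section
/- Let E be a real normed vector space, let Y ⊆ E be a convex set, and let f : E → ℝ be continuous on Y. Suppose that for all y₁, y₂ ∈ Y there exists λ ∈ (0,1) such that f(λ·y₁ + (1−λ)·y₂) ≤ λ·f(y₁) + (1−λ)·f(y₂). Then f is convex on Y, i.e., for all y₁, y₂ ∈ Y and all μ ∈ [0,1], f(μ·y₁ + (1−μ)·y₂) ≤ μ·f(y₁) + (1−μ)·f(y₂). -/
/-- A closed set of reals that meets the open interval between any two of its points is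
order-connected. -/
theorem IsClosed.ordConnected_of_forall_exists_between {S : Set ℝ} (hS : IsClosed S)
    (h : ∀ a ∈ S, ∀ b ∈ S, a < b → (S ∩ Set.Ioo a b).Nonempty) : S.OrdConnected := by
  refine ⟨fun u hu v hv x hx => ?_⟩
  by_contra hxS
  obtain ⟨a, ⟨haS, -, hax⟩, ha⟩ := (isCompact_Icc.inter_left hS).exists_isGreatest
    (⟨u, hu, le_rfl, hx.1⟩ : (S ∩ Set.Icc u x).Nonempty)
  obtain ⟨b, ⟨hbS, hxb, -⟩, hb⟩ := (isCompact_Icc.inter_left hS).exists_isLeast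
    (⟨v, hv, hx.2, le_rfl⟩ : (S ∩ Set.Icc x v).Nonempty)
  have hax' : a < x := lt_of_le_of_ne hax fun e => hxS (e ▸ haS)
  obtain ⟨c, hcS, hac, hcb⟩ := h a haS b hbS (hax'.trans_le hxb)
  have hua : u ≤ a := ha ⟨hu, le_rfl, hx.1⟩
  have hbv : b ≤ v := hb ⟨hv, hx.2, le_rfl⟩
  rcases le_total c x with hcx | hxc
  · exact hac.not_ge (ha ⟨hcS, hua.trans hac.le, hcx⟩)
  · exact hcb.not_ge (hb ⟨hcS, hxc, hcb.le.trans hbv⟩)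

/-- The paper's Convexity Lemma: a continuous function on a convex domain
satisfying a weak (per-pair, single-coefficient) convexity condition is convex. -/
theorem convexity_lemma {E : Type*} [NormedAddCommGroup E] [NormedSpace ℝ E]
    (Y : Set E) (hY : Convex ℝ Y) (f : E → ℝ) (hf : ContinuousOn f Y)
    (h : ∀ y₁ ∈ Y, ∀ y₂ ∈ Y, ∃ l : ℝ, l ∈ Set.Ioo (0:ℝ) 1 ∧
      f (l • y₁ + (1 - l) • y₂) ≤ l * f y₁ + (1 - l) * f y₂) :
    ∀ y₁ ∈ Y, ∀ y₂ ∈ Y, ∀ μ ∈ Set.Icc (0:ℝ) 1,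
      f (μ • y₁ + (1 - μ) • y₂) ≤ μ * f y₁ + (1 - μ) * f y₂ := by
  intro y₁ hy₁ y₂ hy₂ μ hμ
  let p : ℝ → E := fun t => t • y₁ + (1 - t) • y₂
  let q : ℝ → ℝ := fun t => t * f y₁ + (1 - t) * f y₂
  have hpY : Set.MapsTo p (Set.Icc 0 1) Y := fun t ht =>
    hY hy₁ hy₂ ht.1 (sub_nonneg.2 ht.2) (add_sub_cancel t 1)
  have hfp : ContinuousOn (fun t => f (p t)) (Set.Icc 0 1) :=
    hf.comp (by fun_prop) hpY
  have hclosed : IsClosed {t ∈ Set.Icc (0:ℝ) 1 | f (p t) ≤ q t} :=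
    isClosed_Icc.isClosed_le hfp (by fun_prop)
  have hconn := hclosed.ordConnected_of_forall_exists_between <| by
    rintro a ⟨ha, hfa⟩ b ⟨hb, hfb⟩ hab
    obtain ⟨l, ⟨hl₀, hl₁⟩, hl⟩ := h (p a) (hpY ha) (p b) (hpY hb)
    have hp : l • p a + (1 - l) • p b = p (l * a + (1 - l) * b) := by
      simp only [p]
      module
    have hac : a < l * a + (1 - l) * b := by nlinarith
    have hcb : l * a + (1 - l) * b < b := by nlinarith
    refine ⟨l * a + (1 - l) * b, ⟨⟨ha.1.trans hac.le, hcb.le.trans hb.2⟩, ?_⟩, hac, hcb⟩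
    calc f (p (l * a + (1 - l) * b)) ≤ l * f (p a) + (1 - l) * f (p b) := hp ▸ hl
      _ ≤ l * q a + (1 - l) * q b := by
        have : 0 ≤ 1 - l := sub_nonneg.2 hl₁.le
        gcongr
      _ = q (l * a + (1 - l) * b) := by
        simp only [q]
        ring
  exact (hconn.out ⟨Set.left_mem_Icc.2 zero_le_one, by simp [p, q]⟩
    ⟨Set.right_mem_Icc.2 zero_le_one, by simp [p, q]⟩ hμ).2
end

section
/- Let 0 ≤ β₁ < β₂. Let π₁* be a minimizer of π ↦ max_{ω ∈ Ω} (β₁·r*(ω) − r(π, ω)) and π₂* a minimizer of π ↦ max_{ω ∈ Ω} (β₂·r*(ω) − r(π, ω)). Let ω₂₁* be a maximizer of ω ↦ β₂·r*(ω) − r(π₁*, ω) and ω₁₂* a maximizer of ω ↦ β₁·r*(ω) − r(π₂*, ω). Then r*(ω₂₁*) ≥ (D(β₂) − D(β₁)) / (β₂ − β₁) ≥ r*(ω₁₂*). -/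
/-- `F r rs β π` is the worst regret guarantee `max_{ω ∈ Ω} (β·r*(ω) − r(π, ω))`. -/
noncomputable def Fobj {P O : Type*} [Fintype O] [Nonempty O]
    (r : P → O → ℝ) (rs : O → ℝ) (β : ℝ) (π : P) : ℝ :=
  Finset.univ.sup' Finset.univ_nonempty (fun ω => β * rs ω - r π ω)

/-- `Dval r rs β = min_{π ∈ Π} max_{ω ∈ Ω} (β·r*(ω) − r(π, ω))`. -/
noncomputable def Dval {P O : Type*} [Fintype P] [Nonempty P] [Fintype O] [Nonempty O]
    (r : P → O → ℝ) (rs : O → ℝ) (β : ℝ) : ℝ :=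
  Finset.univ.inf' Finset.univ_nonempty (Fobj r rs β)

theorem le_Fobj {P O : Type*} [Fintype O] [Nonempty O]
    (r : P → O → ℝ) (rs : O → ℝ) (β : ℝ) (π : P) (ω : O) :
    β * rs ω - r π ω ≤ Fobj r rs β π :=
  Finset.le_sup' (fun ω => β * rs ω - r π ω) (Finset.mem_univ ω)

theorem Fobj_le_of_forall_le {P O : Type*} [Fintype O] [Nonempty O]
    {r : P → O → ℝ} {rs : O → ℝ} {β : ℝ} {π : P} {a : ℝ}
    (h : ∀ ω, β * rs ω - r π ω ≤ a) : Fobj r rs β π ≤ a :=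
  Finset.sup'_le _ _ fun ω _ => h ω

theorem Dval_le_Fobj {P O : Type*} [Fintype P] [Nonempty P] [Fintype O] [Nonempty O]
    (r : P → O → ℝ) (rs : O → ℝ) (β : ℝ) (π : P) :
    Dval r rs β ≤ Fobj r rs β π :=
  Finset.inf'_le _ (Finset.mem_univ π)

theorem Fobj_le_Dval_of_forall_le {P O : Type*} [Fintype P] [Nonempty P]
    [Fintype O] [Nonempty O] {r : P → O → ℝ} {rs : O → ℝ} {β : ℝ} {π : P}
    (h : ∀ π', Fobj r rs β π ≤ Fobj r rs β π') : Fobj r rs β π ≤ Dval r rs β :=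
  Finset.le_inf' _ _ fun π' _ => h π'

/-- Slope bounds: the difference quotient of `D` between `β₁ < β₂` is sandwiched between
`r*(ω₁₂*)` and `r*(ω₂₁*)`. -/
theorem slope_bounds {P O : Type*} [Fintype P] [Nonempty P] [Fintype O] [Nonempty O]
    (r : P → O → ℝ) (rs : O → ℝ) (β₁ β₂ : ℝ) (hβ₁ : 0 ≤ β₁) (hβ : β₁ < β₂)
    (π₁ π₂ : P)
    (hπ₁ : ∀ π, Fobj r rs β₁ π₁ ≤ Fobj r rs β₁ π)
    (hπ₂ : ∀ π, Fobj r rs β₂ π₂ ≤ Fobj r rs β₂ π)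
    (ω₂₁ ω₁₂ : O)
    (hω₂₁ : ∀ ω, β₂ * rs ω - r π₁ ω ≤ β₂ * rs ω₂₁ - r π₁ ω₂₁)
    (hω₁₂ : ∀ ω, β₁ * rs ω - r π₂ ω ≤ β₁ * rs ω₁₂ - r π₂ ω₁₂) :
    rs ω₂₁ ≥ (Dval r rs β₂ - Dval r rs β₁) / (β₂ - β₁) ∧
      (Dval r rs β₂ - Dval r rs β₁) / (β₂ - β₁) ≥ rs ω₁₂ := by
  have hpos : 0 < β₂ - β₁ := sub_pos.2 hβ
  constructor
  · rw [ge_iff_le, div_le_iff₀ hpos]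
    linarith [Dval_le_Fobj r rs β₂ π₁, Fobj_le_of_forall_le hω₂₁,
      le_Fobj r rs β₁ π₁ ω₂₁, Fobj_le_Dval_of_forall_le hπ₁]
  · rw [ge_iff_le, le_div_iff₀ hpos]
    linarith [Dval_le_Fobj r rs β₁ π₂, Fobj_le_of_forall_le hω₁₂,
      le_Fobj r rs β₂ π₂ ω₁₂, Fobj_le_Dval_of_forall_le hπ₂]
end

section
/- Let Π̂ ⊆ Π be a subset such that every π ∈ Π is dominated by some π̂ ∈ Π̂, where π̂ dominates π means r(π̂, ω) ≥ r(π, ω) for all ω ∈ Ω. Then Π has the RDC property if and only if Π̂ has the RDC property. -/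
/-- A set `S` of policies has the reward dominance convexity (RDC) property if for all
`π₁, π₂ ∈ S` there are `π ∈ S` and `λ ∈ (0,1)` with
`r(π, ω) ≥ λ·r(π₁, ω) + (1−λ)·r(π₂, ω)` for all `ω`. -/
def RDC {P O : Type*} (r : P → O → ℝ) (S : Set P) : Prop :=
  ∀ π₁ ∈ S, ∀ π₂ ∈ S, ∃ π ∈ S, ∃ l : ℝ, l ∈ Set.Ioo (0:ℝ) 1 ∧
    ∀ ω : O, r π ω ≥ l * r π₁ ω + (1 - l) * r π₂ ω

/-- Elimination invariance: if every policy is dominated by a policy in `S`,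
then the whole policy set has RDC iff `S` has RDC. -/
theorem RDC_elimination_invariance {P O : Type*} [Nonempty P] [Nonempty O]
    (r : P → O → ℝ) (S : Set P)
    (hdom : ∀ π : P, ∃ πh ∈ S, ∀ ω : O, r πh ω ≥ r π ω) :
    RDC r Set.univ ↔ RDC r S := by
  constructor
  · intro h π₁ _ π₂ _
    obtain ⟨π, -, l, hl, hπ⟩ := h π₁ trivial π₂ trivial
    obtain ⟨πh, hS, hd⟩ := hdom π
    exact ⟨πh, hS, l, hl, fun ω => (hπ ω).trans (hd ω)⟩
  · intro h π₁ _ π₂ _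
    obtain ⟨σ₁, hσ₁, hd₁⟩ := hdom π₁
    obtain ⟨σ₂, hσ₂, hd₂⟩ := hdom π₂
    obtain ⟨π, -, l, hl, hπ⟩ := h σ₁ hσ₁ σ₂ hσ₂
    refine ⟨π, trivial, l, hl, fun ω => le_trans ?_ (hπ ω)⟩
    exact add_le_add (mul_le_mul_of_nonneg_left (hd₁ ω) hl.1.le)
      (mul_le_mul_of_nonneg_left (hd₂ ω) (sub_nonneg.2 hl.2.le))
end

section
/- Fix β ∈ ℝ and let Π*(β) = {π ∈ Π : F(β, π) = D(β)} be the set of optimal policies at β. If Π has the RDC property, then Π*(β) is nonempty and also has the RDC property, i.e., for all π₁*, π₂* ∈ Π*(β) there exist π ∈ Π*(β) and λ ∈ (0,1) such that r(π, ω) ≥ λ·r(π₁*, ω) + (1−λ)·r(π₂*, ω) for all ω ∈ Ω. -/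
/-- A policy dominating a convex combination of two policies has worst regret at most any common
bound on theirs. -/
theorem Fobj_le_of_dominates {P O : Type*} [Fintype O] [Nonempty O]
    {r : P → O → ℝ} {rs : O → ℝ} {β d l : ℝ} {π π₁ π₂ : P}
    (hl : l ∈ Set.Ioo (0:ℝ) 1) (h₁ : Fobj r rs β π₁ ≤ d) (h₂ : Fobj r rs β π₂ ≤ d)
    (hdom : ∀ ω : O, r π ω ≥ l * r π₁ ω + (1 - l) * r π₂ ω) :
    Fobj r rs β π ≤ d := by
  simp only [Fobj, Finset.sup'_le_iff, Finset.mem_univ, true_imp_iff] at h₁ h₂ ⊢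
  intro ω
  have h₁' := mul_le_mul_of_nonneg_left (h₁ ω) hl.1.le
  have h₂' := mul_le_mul_of_nonneg_left (h₂ ω) (sub_nonneg.mpr hl.2.le)
  linarith [hdom ω]

/-- If `Π` has RDC, then the set `Π*(β)` of optimal policies at `β` is nonempty
and also has RDC.  Here `D β` is the infimum of `F β ·`, assumed attained. -/
theorem RDC_optimal_policies {P O : Type*} [Nonempty P] [Fintype O] [Nonempty O]
    (r : P → O → ℝ) (rs : O → ℝ) (D : ℝ → ℝ)
    (hDle : ∀ (β : ℝ) (π : P), D β ≤ Fobj r rs β π)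
    (hDatt : ∀ β : ℝ, ∃ π : P, Fobj r rs β π = D β)
    (hRDC : RDC r Set.univ) (β : ℝ) :
    ({π : P | Fobj r rs β π = D β}).Nonempty ∧
      RDC r {π : P | Fobj r rs β π = D β} := by
  refine ⟨hDatt β, fun π₁ h₁ π₂ h₂ => ?_⟩
  obtain ⟨π, -, l, hl, hdom⟩ := hRDC π₁ trivial π₂ trivial
  exact ⟨π, (Fobj_le_of_dominates hl h₁.le h₂.le hdom).antisymm (hDle β π), l, hl, hdom⟩
end

section
/- If Π has the RDC property, then for all β₁, β₂ ∈ ℝ there exists λ ∈ (0,1) such that D(λ·β₁ + (1−λ)·β₂) ≤ λ·D(β₁) + (1−λ)·D(β₂). -/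
/-- If `Π` has RDC, then `D` satisfies the weak convexity inequality:
for all `β₁, β₂` there is `λ ∈ (0,1)` with
`D(λβ₁ + (1−λ)β₂) ≤ λ·D(β₁) + (1−λ)·D(β₂)`. -/
theorem RDC_weak_convexity {P O : Type*} [Nonempty P] [Fintype O] [Nonempty O]
    (r : P → O → ℝ) (rs : O → ℝ) (D : ℝ → ℝ)
    (hDle : ∀ (β : ℝ) (π : P), D β ≤ Fobj r rs β π)
    (hDatt : ∀ β : ℝ, ∃ π : P, Fobj r rs β π = D β)
    (hRDC : RDC r Set.univ) :
    ∀ β₁ β₂ : ℝ, ∃ l : ℝ, l ∈ Set.Ioo (0:ℝ) 1 ∧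
      D (l * β₁ + (1 - l) * β₂) ≤ l * D β₁ + (1 - l) * D β₂ := by
  intro β₁ β₂
  obtain ⟨π₁, h₁⟩ := hDatt β₁
  obtain ⟨π₂, h₂⟩ := hDatt β₂
  obtain ⟨π, -, l, hl, hπ⟩ := hRDC π₁ trivial π₂ trivial
  refine ⟨l, hl, (hDle _ π).trans (Finset.sup'_le _ _ fun ω _ => ?_)⟩
  have regret_le (β : ℝ) (π : P) : β * rs ω - r π ω ≤ Fobj r rs β π :=
    Finset.le_sup' (fun ω => β * rs ω - r π ω) (Finset.mem_univ ω)
  rw [← h₁, ← h₂]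
  linarith [hπ ω, mul_le_mul_of_nonneg_left (regret_le β₁ π₁) hl.1.le,
    mul_le_mul_of_nonneg_left (regret_le β₂ π₂) (sub_nonneg.2 hl.2.le)]
end

section
/- If Π has the RDC property and the function D : ℝ → ℝ is continuous, then D is convex on ℝ. -/
/-- A continuous function on `ℝ` which between any two points lies weakly below the chord at some
strictly intermediate point, and is nonpositive at `0` and `1`, is nonpositive on `[0, 1]`. -/
theorem nonpos_of_exists_le_chord {h : ℝ → ℝ} (hc : Continuous h)
    (hch : ∀ s t : ℝ, ∃ l ∈ Set.Ioo (0 : ℝ) 1,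
      h (l * s + (1 - l) * t) ≤ l * h s + (1 - l) * h t)
    (h0 : h 0 ≤ 0) (h1 : h 1 ≤ 0) {c : ℝ} (hc0 : 0 ≤ c) (hc1 : c ≤ 1) : h c ≤ 0 := by
  by_contra! hpos
  have hcl : IsClosed {t | h t ≤ 0} := isClosed_le hc continuous_const
  obtain ⟨p, ⟨⟨hp0, hpc⟩, hp⟩, hpmax⟩ := (isCompact_Icc.inter_right hcl).exists_isGreatest
    ⟨0, ⟨le_rfl, hc0⟩, h0⟩
  obtain ⟨q, ⟨⟨hqc, hq1⟩, hq⟩, hqmin⟩ := (isCompact_Icc.inter_right hcl).exists_isLeast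
    ⟨1, ⟨hc1, le_rfl⟩, h1⟩
  change h p ≤ 0 at hp
  change h q ≤ 0 at hq
  have hpc' : p < c := lt_of_le_of_ne hpc (by rintro rfl; linarith)
  have hpq : p < q := hpc'.trans_le hqc
  obtain ⟨l, ⟨hl0, hl1⟩, hl⟩ := hch p q
  have hm : h (l * p + (1 - l) * q) ≤ 0 := by nlinarith
  have hpm : p < l * p + (1 - l) * q := by nlinarith
  have hmq : l * p + (1 - l) * q < q := by nlinarith
  rcases le_total (l * p + (1 - l) * q) c with hle | hle
  · exact hpm.not_ge (hpmax ⟨⟨hp0.trans hpm.le, hle⟩, hm⟩)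
  · exact hmq.not_ge (hqmin ⟨⟨hle, hmq.le.trans hq1⟩, hm⟩)

/-- A continuous function on `ℝ` which between any two points lies weakly below the chord at some
strictly intermediate point is convex. -/
theorem convexOn_univ_of_exists_le_chord {f : ℝ → ℝ} (hf : Continuous f)
    (hch : ∀ x y : ℝ, ∃ l ∈ Set.Ioo (0 : ℝ) 1,
      f (l * x + (1 - l) * y) ≤ l * f x + (1 - l) * f y) :
    ConvexOn ℝ Set.univ f := by
  refine ⟨convex_univ, fun x _ y _ a b ha hb hab => ?_⟩
  obtain rfl : a = 1 - b := by linarith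
  have key := nonpos_of_exists_le_chord
    (h := fun t => f ((1 - t) * x + t * y) - ((1 - t) * f x + t * f y)) (by fun_prop)
    (fun s t => ?_) (by simp) (by simp) hb (by linarith)
  · simpa [smul_eq_mul] using key
  · obtain ⟨l, hl, hle⟩ := hch ((1 - s) * x + s * y) ((1 - t) * x + t * y)
    refine ⟨l, hl, ?_⟩
    have harg : (1 - (l * s + (1 - l) * t)) * x + (l * s + (1 - l) * t) * y
        = l * ((1 - s) * x + s * y) + (1 - l) * ((1 - t) * x + t * y) := by ring
    simp only [harg]
    linarith

/-- If `Π` has RDC and `D` is continuous, then `D` is convex on `ℝ`. -/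
theorem RDC_convexity {P O : Type*} [Nonempty P] [Fintype O] [Nonempty O]
    (r : P → O → ℝ) (rs : O → ℝ) (D : ℝ → ℝ)
    (hDle : ∀ (β : ℝ) (π : P), D β ≤ Fobj r rs β π)
    (hDatt : ∀ β : ℝ, ∃ π : P, Fobj r rs β π = D β)
    (hRDC : RDC r Set.univ) (hcont : Continuous D) :
    ConvexOn ℝ Set.univ D := by
  refine convexOn_univ_of_exists_le_chord hcont fun x y => ?_
  obtain ⟨π₁, h₁⟩ := hDatt x
  obtain ⟨π₂, h₂⟩ := hDatt y
  obtain ⟨π, -, l, hl, hr⟩ := hRDC π₁ trivial π₂ trivial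
  refine ⟨l, hl, (hDle _ π).trans (Finset.sup'_le _ _ fun ω _ => ?_)⟩
  have b₁ : x * rs ω - r π₁ ω ≤ D x :=
    h₁ ▸ Finset.le_sup' (fun ω => x * rs ω - r π₁ ω) (Finset.mem_univ ω)
  have b₂ : y * rs ω - r π₂ ω ≤ D y :=
    h₂ ▸ Finset.le_sup' (fun ω => y * rs ω - r π₂ ω) (Finset.mem_univ ω)
  have c₁ := mul_le_mul_of_nonneg_left b₁ hl.1.le
  have c₂ := mul_le_mul_of_nonneg_left b₂ (sub_nonneg.2 hl.2.le)
  linarith [hr ω]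
end

section
/- Assume r*(ω) > 0 for all ω ∈ Ω. If β₀ ∈ ℝ satisfies D(β₀) = 0, then β₀ equals the competitive ratio, i.e., β₀ = max_{π ∈ Π} min_{ω ∈ Ω} r(π, ω) / r*(ω). -/
/-- CR equivalence (value): if `r* > 0` on `Ω` and `D(β₀) = 0`, then `β₀` is exactly the
competitive ratio `max_{π} min_{ω} r(π,ω)/r*(ω)`. -/
theorem cr_equivalence_value {P O : Type*} [Fintype P] [Nonempty P] [Fintype O] [Nonempty O]
    (r : P → O → ℝ) (rs : O → ℝ) (hrs : ∀ ω, 0 < rs ω)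
    (β₀ : ℝ) (hβ₀ : Dval r rs β₀ = 0) :
    β₀ = Finset.univ.sup' Finset.univ_nonempty
      (fun π : P => Finset.univ.inf' Finset.univ_nonempty (fun ω : O => r π ω / rs ω)) := by
  apply le_antisymm
  · obtain ⟨π, -, hπ⟩ := Finset.exists_mem_eq_inf' Finset.univ_nonempty (Fobj r rs β₀)
    have h_zero : Fobj r rs β₀ π = 0 := hπ.symm.trans hβ₀
    refine Finset.le_sup'_of_le _ (Finset.mem_univ π) (Finset.le_inf' _ _ fun ω _ => ?_)
    have h_regret : β₀ * rs ω - r π ω ≤ Fobj r rs β₀ π :=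
      Finset.le_sup' (fun ω => β₀ * rs ω - r π ω) (Finset.mem_univ ω)
    rw [le_div_iff₀ (hrs ω)]
    linarith
  · refine Finset.sup'_le _ _ fun π _ => ?_
    have h_nonneg : 0 ≤ Fobj r rs β₀ π :=
      hβ₀.symm.le.trans (Finset.inf'_le _ (Finset.mem_univ π))
    obtain ⟨ω, -, hω⟩ := (Finset.le_sup'_iff _).mp h_nonneg
    refine Finset.inf'_le_of_le _ (Finset.mem_univ ω) ?_
    rw [div_le_iff₀ (hrs ω)]
    linarith
end

section
/- Assume r*(ω) > 0 for all ω ∈ Ω, and let β₀ ∈ ℝ satisfy D(β₀) = 0. Then a policy π* ∈ Π minimizes π ↦ max_{ω ∈ Ω} (β₀·r*(ω) − r(π, ω)) over Π if and only if π* maximizes π ↦ min_{ω ∈ Ω} r(π, ω) / r*(ω) over Π; that is, the set of optimal policies for the adjustable regret criterion at β₀ coincides with the set of optimal policies for the competitive ratio criterion. -/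
theorem Fobj_nonpos_iff {P O : Type*} [Fintype O] [Nonempty O]
    (r : P → O → ℝ) (rs : O → ℝ) (hrs : ∀ ω, 0 < rs ω) (β : ℝ) (π : P) :
    Fobj r rs β π ≤ 0 ↔
      β ≤ Finset.univ.inf' Finset.univ_nonempty (fun ω : O => r π ω / rs ω) := by
  simp [Fobj, Finset.sup'_le_iff, Finset.le_inf'_iff, le_div_iff₀ (hrs _)]

theorem Fobj_neg_iff {P O : Type*} [Fintype O] [Nonempty O]
    (r : P → O → ℝ) (rs : O → ℝ) (hrs : ∀ ω, 0 < rs ω) (β : ℝ) (π : P) :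
    Fobj r rs β π < 0 ↔
      β < Finset.univ.inf' Finset.univ_nonempty (fun ω : O => r π ω / rs ω) := by
  simp [Fobj, Finset.sup'_lt_iff, Finset.lt_inf'_iff, lt_div_iff₀ (hrs _)]

/-- CR equivalence (policies): if `r* > 0` on `Ω` and `D(β₀) = 0`, then a policy is optimal
for the adjustable regret criterion at `β₀` iff it is optimal for the competitive ratio
criterion. -/
theorem cr_equivalence_policies {P O : Type*} [Fintype P] [Nonempty P] [Fintype O] [Nonempty O]
    (r : P → O → ℝ) (rs : O → ℝ) (hrs : ∀ ω, 0 < rs ω)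
    (β₀ : ℝ) (hβ₀ : Dval r rs β₀ = 0) (π' : P) :
    (∀ π : P, Fobj r rs β₀ π' ≤ Fobj r rs β₀ π) ↔
      (∀ π : P,
        Finset.univ.inf' Finset.univ_nonempty (fun ω : O => r π ω / rs ω) ≤
          Finset.univ.inf' Finset.univ_nonempty (fun ω : O => r π' ω / rs ω)) := by
  have h_nonneg (π : P) : 0 ≤ Fobj r rs β₀ π :=
    hβ₀ ▸ Finset.inf'_le (Fobj r rs β₀) (Finset.mem_univ π)
  have h_ratio_le (π : P) :
      Finset.univ.inf' Finset.univ_nonempty (fun ω : O => r π ω / rs ω) ≤ β₀ :=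
    not_lt.1 fun h => (h_nonneg π).not_gt ((Fobj_neg_iff r rs hrs β₀ π).2 h)
  obtain ⟨π₀, -, h₀⟩ := Finset.exists_mem_eq_inf' Finset.univ_nonempty (Fobj r rs β₀)
  have h_zero : Fobj r rs β₀ π₀ = 0 := h₀.symm.trans hβ₀
  constructor
  · intro h π
    exact (h_ratio_le π).trans ((Fobj_nonpos_iff r rs hrs β₀ π').1 ((h π₀).trans h_zero.le))
  · intro h π
    have h_le := ((Fobj_nonpos_iff r rs hrs β₀ π₀).1 h_zero.le).trans (h π₀)
    exact ((Fobj_nonpos_iff r rs hrs β₀ π').2 h_le).trans (h_nonneg π)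
end

section
/- Assume r(π, ω) ≤ r*(ω) for all π ∈ Π and ω ∈ Ω. If D(0) < 0, then r*(ω) > 0 for all ω ∈ Ω, and there exists a unique β₀ ∈ (0, 1] such that D(β₀) = 0. -/
theorem lt_Dval_iff {P O : Type*} [Fintype P] [Nonempty P] [Fintype O] [Nonempty O]
    {r : P → O → ℝ} {rs : O → ℝ} {β c : ℝ} :
    c < Dval r rs β ↔ ∀ π, ∃ ω, c < β * rs ω - r π ω := by
  simp [Dval, Fobj, Finset.lt_inf'_iff, Finset.lt_sup'_iff]

theorem Dval_lt_iff {P O : Type*} [Fintype P] [Nonempty P] [Fintype O] [Nonempty O]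
    {r : P → O → ℝ} {rs : O → ℝ} {β c : ℝ} :
    Dval r rs β < c ↔ ∃ π, ∀ ω, β * rs ω - r π ω < c := by
  simp [Dval, Fobj, Finset.inf'_lt_iff, Finset.sup'_lt_iff]

theorem continuous_Dval {P O : Type*} [Fintype P] [Nonempty P] [Fintype O] [Nonempty O]
    (r : P → O → ℝ) (rs : O → ℝ) : Continuous (Dval r rs) := by
  unfold Dval Fobj
  refine Continuous.finset_inf'_apply _ fun π _ => ?_
  refine Continuous.finset_sup'_apply _ fun ω _ => ?_
  fun_prop

theorem strictMono_Dval {P O : Type*} [Fintype P] [Nonempty P] [Fintype O] [Nonempty O]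
    (r : P → O → ℝ) {rs : O → ℝ} (hrs : ∀ ω, 0 < rs ω) : StrictMono (Dval r rs) := by
  intro a b hab
  refine lt_Dval_iff.2 fun π => ?_
  obtain ⟨ω, -, hω⟩ := Finset.exists_mem_eq_sup' Finset.univ_nonempty
    (fun ω => a * rs ω - r π ω)
  have hle : Dval r rs a ≤ Fobj r rs a π := Finset.inf'_le _ (Finset.mem_univ π)
  refine ⟨ω, (hle.trans hω.le).trans_lt ?_⟩
  exact sub_lt_sub_right (mul_lt_mul_of_pos_right hab (hrs ω)) _

/-- If `r(π,ω) ≤ r*(ω)` always and `D(0) < 0`, then `r*` is positive on all scenarios and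
there is a unique `β₀ ∈ (0, 1]` with `D(β₀) = 0`. -/
theorem unique_competitive_ratio {P O : Type*} [Fintype P] [Nonempty P] [Fintype O] [Nonempty O]
    (r : P → O → ℝ) (rs : O → ℝ)
    (hle : ∀ (π : P) (ω : O), r π ω ≤ rs ω)
    (h0 : Dval r rs 0 < 0) :
    (∀ ω, 0 < rs ω) ∧ ∃! β₀ : ℝ, β₀ ∈ Set.Ioc (0:ℝ) 1 ∧ Dval r rs β₀ = 0 := by
  obtain ⟨π, hπ⟩ := Dval_lt_iff.1 h0
  have hrs : ∀ ω, 0 < rs ω := fun ω => by linarith [hπ ω, hle π ω]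
  refine ⟨hrs, ?_⟩
  have h1 : 0 ≤ Dval r rs 1 := by
    by_contra! h
    obtain ⟨π', hπ'⟩ := Dval_lt_iff.1 h
    obtain ⟨ω⟩ := ‹Nonempty O›
    linarith [hπ' ω, hle π' ω]
  obtain ⟨β, hβ, hD⟩ := intermediate_value_Ioc zero_le_one
    (continuous_Dval r rs).continuousOn ⟨h0, h1⟩
  exact ⟨β, ⟨hβ, hD⟩, fun γ hγ => (strictMono_Dval r hrs).injective (hγ.2.trans hD.symm)⟩
end

section
/- For every β > 0, the best adjustable regret guarantee for the one-way trading problem equals D(β) = β·(M − m)·(max(0, 1 − 1/(β·T)))^T − (1 − β)·m. -/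
open scoped BigOperators

namespace OneWayTrading

/-- The regret of the policy `σ` on the price path `p`, adjusted by `β`. -/
noncomputable def regret (β : ℝ) {T : ℕ} (σ : List ℝ → ℝ) (p : Fin T → ℝ) : ℝ :=
  β * (⨆ t : Fin T, p t) - ∑ t : Fin T, p t * σ ((List.ofFn p).take (t.1 + 1))

/-- The nonnegative amounts sold along every admissible prefix add up to one on every path. -/
def IsPolicy (m M : ℝ) (T : ℕ) (σ : List ℝ → ℝ) : Prop :=
  (∀ l : List ℝ, l.length ≤ T → (∀ y ∈ l, y ∈ Set.Icc m M) → 0 ≤ σ l) ∧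
    ∀ p : Fin T → ℝ, (∀ t, p t ∈ Set.Icc m M) →
      ∑ t : Fin T, σ ((List.ofFn p).take (t.1 + 1)) = 1

theorem mem_Icc_of_mem_take_ofFn {m M : ℝ} {T : ℕ} {p : Fin T → ℝ}
    (hp : ∀ t, p t ∈ Set.Icc m M) (k : ℕ) :
    ∀ y ∈ (List.ofFn p).take k, y ∈ Set.Icc m M := by
  intro y hy
  obtain ⟨t, rfl⟩ := (List.mem_ofFn).1 (List.mem_of_mem_take hy)
  exact hp t

theorem IsPolicy.nonneg_take {m M : ℝ} {T : ℕ} {σ : List ℝ → ℝ} (hσ : IsPolicy m M T σ)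
    {p : Fin T → ℝ} (hp : ∀ t, p t ∈ Set.Icc m M) (k : ℕ) :
    0 ≤ σ ((List.ofFn p).take k) :=
  hσ.1 _ (by simp) (mem_Icc_of_mem_take_ofFn hp k)

theorem IsPolicy.regret_le {m M : ℝ} (hm : 0 < m) {T : ℕ} (hT : 1 ≤ T) {β : ℝ} (hβ : 0 < β)
    {σ : List ℝ → ℝ} (hσ : IsPolicy m M T σ) {p : Fin T → ℝ}
    (hp : ∀ t, p t ∈ Set.Icc m M) : regret β σ p ≤ β * M := by
  have : Nonempty (Fin T) := ⟨⟨0, hT⟩⟩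
  have h1 : ⨆ t : Fin T, p t ≤ M := ciSup_le fun t => (hp t).2
  have h2 : 0 ≤ ∑ t : Fin T, p t * σ ((List.ofFn p).take (t.1 + 1)) :=
    Finset.sum_nonneg fun t _ => mul_nonneg (hm.le.trans (hp t).1) (hσ.nonneg_take hp _)
  have h3 := mul_le_mul_of_nonneg_left h1 hβ.le
  unfold regret
  linarith

/-! ### Lower bound -/

/-- Averaging the regrets of the geometric price paths with geometric weights. -/
theorem le_of_geometric_regrets {β B c W : ℝ} {n : ℕ} {x : ℕ → ℝ} (hc : 0 < c) (hc1 : c ≤ 1)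
    (hβc : β * (1 - c) * (n + 1) = 1) (hx : ∑ t ∈ Finset.range (n + 1), x t = 1)
    (hW : ∀ k ≤ n, β * (B * c ^ (n - k)) -
      ∑ t ∈ Finset.range (k + 1), B * c ^ (n - t) * x t ≤ W) :
    β * B * c ^ (n + 1) ≤ W := by
  have key : ∀ j ≤ n, j * (1 - c) * (β * B * c ^ n) +
      c ^ j * (∑ t ∈ Finset.range j, B * c ^ (n - t) * x t) -
      B * c ^ n * ∑ t ∈ Finset.range j, x t ≤ (1 - c ^ j) * W := by
    intro j
    induction j with
    | zero => simp
    | succ j ih =>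
      intro hj
      have h1 := ih (by omega)
      have h2 := mul_le_mul_of_nonneg_left (hW j (by omega))
        (mul_nonneg (sub_nonneg.2 hc1) (pow_pos hc j).le)
      have h3 : c ^ n = c ^ j * c ^ (n - j) := by rw [← pow_add]; congr 1; omega
      rw [Finset.sum_range_succ] at h2
      rw [Finset.sum_range_succ, Finset.sum_range_succ]
      rw [h3] at h1 ⊢
      push_cast
      rw [pow_succ]
      linarith
  have h1 := key n le_rfl
  have h2 := mul_le_mul_of_nonneg_left (hW n le_rfl) (pow_pos hc n).le
  rw [Finset.sum_range_succ] at h2 hx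
  have h3 : ∑ t ∈ Finset.range n, x t = 1 - x n := by linarith
  rw [h3] at h1
  simp only [Nat.sub_self, pow_zero, mul_one] at h2
  have h4 : (n * (1 - c) * β + β - 1) = β * c := by linarith
  have h5 : β * B * c ^ (n + 1) = (n * (1 - c) * β + β - 1) * (B * c ^ n) := by
    rw [h4]; ring
  rw [h5]
  linarith

theorem take_ofFn_congr {T : ℕ} {p q : Fin T → ℝ} {k : ℕ} (h : ∀ t : Fin T, t.1 < k → p t = q t) :
    (List.ofFn p).take k = (List.ofFn q).take k := by
  apply List.ext_getElem
  · simp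
  · intro i h1 h2
    simp only [List.length_take, List.length_ofFn, lt_min_iff] at h1
    simpa using h ⟨i, h1.2⟩ h1.1

/-- Prices rising geometrically to `M` until period `k`, and equal to `m` afterwards. -/
noncomputable def geometricPath (m B c : ℝ) (n k : ℕ) (t : Fin (n + 1)) : ℝ :=
  m + if t.1 ≤ k then B * c ^ (n - t.1) else 0

theorem geometricPath_mem {m M c : ℝ} (hmM : m < M) (hc : 0 < c) (hc1 : c ≤ 1) (n k : ℕ)
    (t : Fin (n + 1)) : geometricPath m (M - m) c n k t ∈ Set.Icc m M := by
  have h0 : 0 < c ^ (n - t.1) := pow_pos hc _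
  have h1 : c ^ (n - t.1) ≤ 1 := pow_le_one₀ hc.le hc1
  unfold geometricPath
  split_ifs
  · constructor <;> nlinarith
  · constructor <;> linarith

theorem le_regret_geometricPath {m M c β : ℝ} (hmM : m < M) (hc : 0 < c) (hc1 : c ≤ 1)
    (hβ : 0 < β) {n k : ℕ} (hk : k ≤ n) {σ : List ℝ → ℝ} (hσ : IsPolicy m M (n + 1) σ) :
    β * ((M - m) * c ^ (n - k)) - (∑ t ∈ Finset.range (k + 1), (M - m) * c ^ (n - t) *
      σ ((List.ofFn (geometricPath m (M - m) c n n)).take (t + 1))) - (1 - β) * m ≤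
    regret β σ (geometricPath m (M - m) c n k) := by
  have hp := geometricPath_mem hmM hc hc1 n k
  have hsup : m + (M - m) * c ^ (n - k) ≤ ⨆ t, geometricPath m (M - m) c n k t := by
    refine le_of_eq_of_le ?_ (le_ciSup (Set.finite_range _).bddAbove ⟨k, by omega⟩)
    simp [geometricPath]
  have hsum : ∑ t : Fin (n + 1), geometricPath m (M - m) c n k t *
      σ ((List.ofFn (geometricPath m (M - m) c n k)).take (t.1 + 1)) =
      m + ∑ t ∈ Finset.range (k + 1), (M - m) * c ^ (n - t) *
        σ ((List.ofFn (geometricPath m (M - m) c n n)).take (t + 1)) := by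
    have hterm : ∀ t : Fin (n + 1), geometricPath m (M - m) c n k t *
        σ ((List.ofFn (geometricPath m (M - m) c n k)).take (t.1 + 1)) =
        m * σ ((List.ofFn (geometricPath m (M - m) c n k)).take (t.1 + 1)) +
        if t.1 ≤ k then (M - m) * c ^ (n - t.1) *
          σ ((List.ofFn (geometricPath m (M - m) c n n)).take (t.1 + 1)) else 0 := by
      intro t
      split_ifs with h
      · rw [take_ofFn_congr (q := geometricPath m (M - m) c n n) (k := t.1 + 1)]
        · simp only [geometricPath, h, if_true]; ring
        · intro s hs
          have hs1 : s.1 ≤ k := by omega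
          have hs2 : s.1 ≤ n := by omega
          simp [geometricPath, hs1, hs2]
      · simp [geometricPath, h]
    rw [Finset.sum_congr rfl fun t _ => hterm t, Finset.sum_add_distrib, ← Finset.mul_sum,
      hσ.2 _ hp, mul_one, Fin.sum_univ_eq_sum_range (fun t => if t ≤ k then (M - m) * c ^ (n - t) *
          σ ((List.ofFn (geometricPath m (M - m) c n n)).take (t + 1)) else 0) (n + 1),
      ← Finset.sum_filter]
    congr 2
    ext t
    simp only [Finset.mem_filter, Finset.mem_range]
    omega
  have := mul_le_mul_of_nonneg_left hsup hβ.le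
  unfold regret
  rw [hsum]
  linarith

theorem regret_const {m M β : ℝ} (hmM : m < M) {T : ℕ} (hT : 1 ≤ T) {σ : List ℝ → ℝ}
    (hσ : IsPolicy m M T σ) : regret β σ (fun _ : Fin T => m) = -((1 - β) * m) := by
  have : Nonempty (Fin T) := ⟨⟨0, hT⟩⟩
  unfold regret
  rw [← Finset.mul_sum, hσ.2 (fun _ => m) fun _ => ⟨le_rfl, hmM.le⟩, ciSup_const]
  ring

/-- Every upper bound of the regrets of a policy is at least the optimal guarantee. -/
theorem IsPolicy.guarantee_le {m M : ℝ} (hmM : m < M) {T : ℕ} (hT : 1 ≤ T) {β : ℝ}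
    (hβ : 0 < β) {σ : List ℝ → ℝ} (hσ : IsPolicy m M T σ) {w : ℝ}
    (hw : ∀ p : Fin T → ℝ, (∀ t, p t ∈ Set.Icc m M) → regret β σ p ≤ w) :
    β * (M - m) * (max 0 (1 - 1 / (β * T))) ^ T - (1 - β) * m ≤ w := by
  have hT0 : (0 : ℝ) < T := by exact_mod_cast hT
  rcases le_or_gt (1 - 1 / (β * T)) 0 with h | h
  · rw [max_eq_left h, zero_pow (by omega), mul_zero, zero_sub, ← regret_const hmM hT hσ]
    exact hw _ fun _ => ⟨le_rfl, hmM.le⟩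
  · rw [max_eq_right h.le]
    have hc1 : 1 - 1 / (β * T) ≤ 1 := sub_le_self _ (by positivity)
    have hβc : β * (1 - (1 - 1 / (β * T))) * T = 1 := by field_simp; ring
    generalize 1 - 1 / (β * T) = c at *
    obtain ⟨n, rfl⟩ : ∃ n, T = n + 1 := ⟨T - 1, by omega⟩
    have := le_of_geometric_regrets (B := M - m) (W := w + (1 - β) * m) h hc1
      (x := fun t => σ ((List.ofFn (geometricPath m (M - m) c n n)).take (t + 1)))
      (by exact_mod_cast hβc)
      (by rw [← Fin.sum_univ_eq_sum_range]; exact hσ.2 _ (geometricPath_mem hmM h hc1 n n))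
      fun k hk => by
        have h1 := le_regret_geometricPath hmM h hc1 hβ hk hσ
        have h2 := hw _ (geometricPath_mem hmM h hc1 n k)
        linarith
    linarith

/-! ### Upper bound -/

/-- Selling the same amount in each period is optimal when `β * T ≤ 1`. -/
theorem regret_uniform_le {m M β : ℝ} {T : ℕ} (hT : 1 ≤ T) (hβT : β * T ≤ 1)
    {p : Fin T → ℝ} (hp : ∀ t, p t ∈ Set.Icc m M) :
    regret β (fun _ => 1 / (T : ℝ)) p ≤ -((1 - β) * m) := by
  have : Nonempty (Fin T) := ⟨⟨0, hT⟩⟩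
  have hT0 : (0 : ℝ) < T := by exact_mod_cast hT
  obtain ⟨s, hs⟩ := exists_eq_ciSup_of_finite (f := p)
  have h1 : p s - m ≤ ∑ t, (p t - m) :=
    Finset.single_le_sum (f := fun t => p t - m) (fun t _ => sub_nonneg.2 (hp t).1)
      (Finset.mem_univ s)
  rw [Finset.sum_sub_distrib, Finset.sum_const, Finset.card_univ, Fintype.card_fin,
    nsmul_eq_mul] at h1
  have h2 : β ≤ 1 / (T : ℝ) := (le_div_iff₀ hT0).2 hβT
  have h3 := mul_le_mul_of_nonneg_right h2 (sub_nonneg.2 (hp s).1)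
  have h4 := mul_le_mul_of_nonneg_right h1 (one_div_pos.2 hT0).le
  have h5 : (T : ℝ) * (1 / (T : ℝ)) = 1 := by field_simp
  have h6 : (∑ t, p t - T * m) * (1 / (T : ℝ)) = (∑ t, p t) * (1 / (T : ℝ)) - m := by
    linear_combination (-m) * h5
  unfold regret
  rw [← hs, ← Finset.sum_mul]
  linarith

theorem isPolicy_uniform (m M : ℝ) {T : ℕ} (hT : 1 ≤ T) :
    IsPolicy m M T fun _ => 1 / (T : ℝ) := by
  have hT0 : (0 : ℝ) < T := by exact_mod_cast hT
  refine ⟨fun _ _ _ => by positivity, fun p _ => ?_⟩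
  simp [hT0.ne']

theorem sum_one_sub_div_le {β B c : ℝ} {T : ℕ} (hβ : 0 < β) (hB : 0 < B) (hc : 0 < c)
    (hβc : β * (1 - c) * T = 1) {g : ℕ → ℝ} (hg : ∀ k, 0 < g k) (hg0 : g 0 = B * c ^ T)
    (hgT : g T ≤ B) : ∑ i ∈ Finset.range T, β * (1 - g i / g (i + 1)) ≤ 1 := by
  have h1 : ∀ i, c * (1 + (Real.log (g i) - Real.log (g (i + 1)) - Real.log c)) ≤
      g i / g (i + 1) := by
    intro i
    have hu : 0 < g i / g (i + 1) := div_pos (hg _) (hg _)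
    have := Real.log_le_sub_one_of_pos (div_pos hu hc)
    rw [Real.log_div hu.ne' hc.ne', Real.log_div (hg _).ne' (hg _).ne'] at this
    have h2 := mul_le_mul_of_nonneg_left this hc.le
    have h3 : c * (g i / g (i + 1) / c - 1) = g i / g (i + 1) - c := by
      rw [mul_sub, mul_div_cancel₀ _ hc.ne', mul_one]
    linarith
  have h2 := Finset.sum_le_sum fun i (_ : i ∈ Finset.range T) => h1 i
  rw [← Finset.mul_sum, Finset.sum_add_distrib, Finset.sum_sub_distrib,
    Finset.sum_range_sub' (fun i => Real.log (g i))] at h2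
  simp only [Finset.sum_const, Finset.card_range, nsmul_eq_mul, mul_one] at h2
  rw [hg0, Real.log_mul hB.ne' (pow_pos hc T).ne', Real.log_pow] at h2
  have h3 : Real.log (g T) ≤ Real.log B := Real.log_le_log (hg T) hgT
  have h4 : c * T ≤ ∑ i ∈ Finset.range T, g i / g (i + 1) := by
    refine le_trans (mul_le_mul_of_nonneg_left ?_ hc.le) h2
    linarith
  rw [← Finset.mul_sum, Finset.sum_sub_distrib]
  simp only [Finset.sum_const, Finset.card_range, nsmul_eq_mul, mul_one]
  have := mul_le_mul_of_nonneg_left h4 hβ.le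
  linarith

/-- The largest excess over `m` of the prices in `l`, floored at `a`. -/
noncomputable def excessMax (m a : ℝ) (l : List ℝ) : ℝ :=
  l.foldl (fun w y => max w (y - m)) a

theorem excessMax_take_succ {m a : ℝ} {l : List ℝ} {k : ℕ} (hk : k < l.length) :
    excessMax m a (l.take (k + 1)) = max (excessMax m a (l.take k)) (l[k] - m) := by
  rw [List.take_succ_eq_append_getElem hk, excessMax, List.foldl_append]
  rfl

theorem monotone_excessMax_take (m a : ℝ) (l : List ℝ) :
    Monotone fun k => excessMax m a (l.take k) := by
  refine monotone_nat_of_le_succ fun k => ?_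
  rcases lt_or_ge k l.length with h | h
  · exact (le_max_left _ _).trans (excessMax_take_succ h).ge
  · rw [List.take_of_length_le h, List.take_of_length_le (by omega)]

theorem le_excessMax_take (m a : ℝ) (l : List ℝ) (k : ℕ) : a ≤ excessMax m a (l.take k) :=
  monotone_excessMax_take m a l (Nat.zero_le k)

theorem excessMax_le {m M a : ℝ} (ha : a ≤ M - m) {l : List ℝ} (hl : ∀ y ∈ l, y ∈ Set.Icc m M) :
    excessMax m a l ≤ M - m := by
  unfold excessMax
  induction l generalizing a with
  | nil => exact ha
  | cons y l ih =>
    refine ih (max_le ha ?_) fun z hz => hl z (List.mem_cons_of_mem _ hz)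
    linarith [(hl y List.mem_cons_self).2]

/-- The amount sold in period `k` by the threat-based policy. -/
noncomputable def threatAmount (m a β : ℝ) (l : List ℝ) (k : ℕ) : ℝ :=
  β * (1 - excessMax m a (l.take k) / excessMax m a (l.take (k + 1)))

/-- Sell just enough to keep the regret below `β * a`, and everything left in the last period. -/
noncomputable def threatPolicy (m a β : ℝ) (n : ℕ) (l : List ℝ) : ℝ :=
  if l.length ≤ n then threatAmount m a β l (l.length - 1)
  else 1 - ∑ i ∈ Finset.range n, threatAmount m a β l i

theorem threatAmount_nonneg {m a β : ℝ} (hβ : 0 < β) (ha : 0 < a) (l : List ℝ) (k : ℕ) :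
    0 ≤ threatAmount m a β l k := by
  refine mul_nonneg hβ.le (sub_nonneg.2 (div_le_one_of_le₀ ?_ ?_))
  · exact monotone_excessMax_take m a l (Nat.le_succ k)
  · exact ha.le.trans (le_excessMax_take m a l _)

theorem threatAmount_take (m a β : ℝ) (l : List ℝ) {j k : ℕ} (h : k < j) :
    threatAmount m a β (l.take j) k = threatAmount m a β l k := by
  simp only [threatAmount, List.take_take, min_eq_left h.le, min_eq_left (Nat.succ_le_of_lt h)]

theorem sum_threatAmount_le_one {m M β c : ℝ} (hmM : m < M) (hβ : 0 < β) (hc : 0 < c)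
    (hc1 : c ≤ 1) {T : ℕ} (hβc : β * (1 - c) * T = 1) {l : List ℝ}
    (hl : ∀ y ∈ l, y ∈ Set.Icc m M) :
    ∑ i ∈ Finset.range T, threatAmount m ((M - m) * c ^ T) β l i ≤ 1 := by
  have hB := sub_pos.2 hmM
  have ha : 0 < (M - m) * c ^ T := mul_pos hB (pow_pos hc T)
  refine sum_one_sub_div_le hβ hB hc hβc
    (g := fun k => excessMax m ((M - m) * c ^ T) (l.take k))
    (fun k => ha.trans_le (le_excessMax_take _ _ _ _)) rfl ?_
  exact excessMax_le (mul_le_of_le_one_right hB.le (pow_le_one₀ hc.le hc1))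
    fun y hy => hl y (List.mem_of_mem_take hy)

theorem threatPolicy_take_ofFn {m a β : ℝ} {n : ℕ} (p : Fin (n + 1) → ℝ) {t : ℕ}
    (ht : t < n) : threatPolicy m a β n ((List.ofFn p).take (t + 1)) =
      threatAmount m a β (List.ofFn p) t := by
  have hlen : ((List.ofFn p).take (t + 1)).length = t + 1 := by simp; omega
  rw [threatPolicy, hlen, if_pos (by omega), Nat.add_sub_cancel,
    threatAmount_take _ _ _ _ (Nat.lt_succ_self t)]

theorem threatPolicy_take_ofFn_last {m a β : ℝ} {n : ℕ} (p : Fin (n + 1) → ℝ) :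
    threatPolicy m a β n ((List.ofFn p).take (n + 1)) =
      1 - ∑ i ∈ Finset.range n, threatAmount m a β (List.ofFn p) i := by
  rw [List.take_of_length_le (by simp), threatPolicy, if_neg (by simp)]

theorem isPolicy_threatPolicy {m M β c : ℝ} (hmM : m < M) (hβ : 0 < β) (hc : 0 < c)
    (hc1 : c ≤ 1) {n : ℕ} (hβc : β * (1 - c) * (n + 1 : ℕ) = 1) :
    IsPolicy m M (n + 1) (threatPolicy m ((M - m) * c ^ (n + 1)) β n) := by
  have ha : 0 < (M - m) * c ^ (n + 1) := mul_pos (sub_pos.2 hmM) (pow_pos hc _)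
  refine ⟨fun l _ hl => ?_, fun p _ => ?_⟩
  · unfold threatPolicy
    split_ifs
    · exact threatAmount_nonneg hβ ha _ _
    · have h1 := sum_threatAmount_le_one hmM hβ hc hc1 hβc hl
      rw [Finset.sum_range_succ] at h1
      have h2 := threatAmount_nonneg (m := m) hβ ha l n
      linarith
  · rw [Fin.sum_univ_eq_sum_range
      (fun t => threatPolicy m ((M - m) * c ^ (n + 1)) β n ((List.ofFn p).take (t + 1))),
      Finset.sum_range_succ, threatPolicy_take_ofFn_last, Finset.sum_congr rfl fun t ht =>
        threatPolicy_take_ofFn p (Finset.mem_range.1 ht)]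
    ring

theorem regret_threatPolicy_le {m M β c : ℝ} (hmM : m < M) (hβ : 0 < β) (hc : 0 < c)
    (hc1 : c ≤ 1) {n : ℕ} (hβc : β * (1 - c) * (n + 1 : ℕ) = 1) {p : Fin (n + 1) → ℝ}
    (hp : ∀ t, p t ∈ Set.Icc m M) :
    regret β (threatPolicy m ((M - m) * c ^ (n + 1)) β n) p ≤
      β * (M - m) * c ^ (n + 1) - (1 - β) * m := by
  have hpol := isPolicy_threatPolicy hmM hβ hc hc1 hβc
  have ha : 0 < (M - m) * c ^ (n + 1) := mul_pos (sub_pos.2 hmM) (pow_pos hc _)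
  have hS := sum_threatAmount_le_one hmM hβ hc hc1 hβc fun y hy => by
    obtain ⟨t, rfl⟩ := (List.mem_ofFn (f := p)).1 hy
    exact hp t
  rw [mul_assoc β]
  generalize (M - m) * c ^ (n + 1) = a at *
  set σ := threatPolicy m a β n
  set g : ℕ → ℝ := fun k => excessMax m a ((List.ofFn p).take k) with hg
  have hmono : Monotone g := monotone_excessMax_take m a _
  have hgpos : ∀ k, 0 < g k := fun k => ha.trans_le (le_excessMax_take _ _ _ _)
  have hsucc : ∀ t : Fin (n + 1), g (t.1 + 1) = max (g t.1) (p t - m) := by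
    intro t
    simp only [hg]
    rw [excessMax_take_succ (by rw [List.length_ofFn]; exact t.2), List.getElem_ofFn]
  have hamount : ∀ t : Fin (n + 1),
      β * (1 - g t.1 / g (t.1 + 1)) ≤ σ ((List.ofFn p).take (t.1 + 1)) := by
    intro t
    rcases Nat.lt_succ_iff_lt_or_eq.1 t.2 with h | h
    · exact (threatPolicy_take_ofFn p h).ge
    · rw [h]
      rw [Finset.sum_range_succ] at hS
      have : σ ((List.ofFn p).take (n + 1)) = _ := threatPolicy_take_ofFn_last p
      rw [this]
      have : β * (1 - g n / g (n + 1)) = threatAmount m a β (List.ofFn p) n := rfl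
      linarith
  have hterm : ∀ t : Fin (n + 1), m * σ ((List.ofFn p).take (t.1 + 1)) +
      β * (g (t.1 + 1) - g t.1) ≤ p t * σ ((List.ofFn p).take (t.1 + 1)) := by
    intro t
    have hσ0 := hpol.nonneg_take hp (t.1 + 1)
    have hq := sub_nonneg.2 (hp t).1
    rcases le_total (p t - m) (g t.1) with h | h
    · rw [hsucc, max_eq_left h, sub_self, mul_zero, add_zero]
      exact mul_le_mul_of_nonneg_right (hp t).1 hσ0
    · have h1 := mul_le_mul_of_nonneg_left (hamount t) hq
      have h2 : g (t.1 + 1) = p t - m := by rw [hsucc, max_eq_right h]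
      have h3 : (p t - m) * (g t.1 / g (t.1 + 1)) = g t.1 := by
        rw [← h2, mul_div_cancel₀ _ (hgpos _).ne']
      have h4 : (p t - m) * (β * (1 - g t.1 / g (t.1 + 1))) = β * (g (t.1 + 1) - g t.1) := by
        rw [h2] at h3 ⊢
        linear_combination (-β) * h3
      linarith
  have hsum := Finset.sum_le_sum fun t (_ : t ∈ Finset.univ) => hterm t
  rw [Finset.sum_add_distrib, ← Finset.mul_sum, hpol.2 p hp, ← Finset.mul_sum,
    Fin.sum_univ_eq_sum_range (fun t => g (t + 1) - g t), Finset.sum_range_sub] at hsum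
  have hg0 : g 0 = a := rfl
  have hsup : ⨆ t, p t ≤ m + g (n + 1) := by
    refine ciSup_le fun t => ?_
    have h1 : p t - m ≤ g (t.1 + 1) := (le_max_right _ _).trans (hsucc t).ge
    have h2 : g (t.1 + 1) ≤ g (n + 1) := hmono t.2
    linarith
  have := mul_le_mul_of_nonneg_left hsup hβ.le
  rw [hg0] at hsum
  unfold regret
  linarith

theorem exists_isPolicy_regret_le {m M : ℝ} (hmM : m < M) {T : ℕ} (hT : 1 ≤ T) {β : ℝ}
    (hβ : 0 < β) : ∃ σ, IsPolicy m M T σ ∧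
      ∀ p : Fin T → ℝ, (∀ t, p t ∈ Set.Icc m M) → regret β σ p ≤
        β * (M - m) * (max 0 (1 - 1 / (β * T))) ^ T - (1 - β) * m := by
  have hT0 : (0 : ℝ) < T := by exact_mod_cast hT
  rcases le_or_gt (1 - 1 / (β * T)) 0 with h | h
  · refine ⟨_, isPolicy_uniform m M hT, fun p hp => ?_⟩
    rw [max_eq_left h, zero_pow (by omega), mul_zero, zero_sub]
    refine regret_uniform_le hT ?_ hp
    rwa [sub_nonpos, le_div_iff₀ (by positivity), one_mul] at h
  · rw [max_eq_right h.le]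
    have hc1 : 1 - 1 / (β * T) ≤ 1 := sub_le_self _ (by positivity)
    have hβc : β * (1 - (1 - 1 / (β * T))) * T = 1 := by field_simp; ring
    generalize 1 - 1 / (β * T) = c at *
    obtain ⟨n, rfl⟩ : ∃ n, T = n + 1 := ⟨T - 1, by omega⟩
    exact ⟨_, isPolicy_threatPolicy hmM hβ h hc1 hβc,
      fun p hp => regret_threatPolicy_le hmM hβ h hc1 hβc hp⟩

end OneWayTrading

open OneWayTrading

/-- The best adjustable regret guarantee for the one-way trading problem:
`D(β) = β·(M − m)·(max(0, 1 − 1/(β·T)))^T − (1 − β)·m`.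
A trading policy is encoded by `σ : List ℝ → ℝ`, giving the amount sold as a function of
the prices revealed so far (the list `p₁, …, p_t`); it must be nonnegative and sell
exactly one unit in total along every price path. -/
theorem one_way_trading_adjustable_regret
    (m M : ℝ) (hm : 0 < m) (hmM : m < M) (T : ℕ) (hT : 1 ≤ T) (β : ℝ) (hβ : 0 < β) :
    sInf { w : ℝ | ∃ σ : List ℝ → ℝ,
        (∀ l : List ℝ, l.length ≤ T → (∀ y ∈ l, y ∈ Set.Icc m M) → 0 ≤ σ l) ∧
        (∀ p : Fin T → ℝ, (∀ t, p t ∈ Set.Icc m M) →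
          ∑ t : Fin T, σ ((List.ofFn p).take (t.1 + 1)) = 1) ∧
        w = sSup { v : ℝ | ∃ p : Fin T → ℝ, (∀ t, p t ∈ Set.Icc m M) ∧
          v = β * (⨆ t : Fin T, p t) -
              ∑ t : Fin T, p t * σ ((List.ofFn p).take (t.1 + 1)) } } =
      β * (M - m) * (max 0 (1 - 1 / (β * T))) ^ T - (1 - β) * m := by
  have hlower : ∀ τ, IsPolicy m M T τ →
      β * (M - m) * (max 0 (1 - 1 / (β * T))) ^ T - (1 - β) * m ≤
        sSup { v : ℝ | ∃ p : Fin T → ℝ, (∀ t, p t ∈ Set.Icc m M) ∧ v = regret β τ p } :=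
    fun τ hτ => hτ.guarantee_le hmM hT hβ fun p hp => le_csSup
      ⟨β * M, by rintro v ⟨q, hq, rfl⟩; exact hτ.regret_le hm hT hβ hq⟩ ⟨p, hp, rfl⟩
  obtain ⟨σ, hσ, hle⟩ := exists_isPolicy_regret_le hmM hT hβ
  refine IsLeast.csInf_eq ⟨⟨σ, hσ.1, hσ.2, le_antisymm (hlower σ hσ) (csSup_le ?_ ?_)⟩, ?_⟩
  · exact ⟨_, fun _ => m, fun _ => ⟨le_rfl, hmM.le⟩, rfl⟩
  · rintro v ⟨p, hp, rfl⟩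
    exact hle p hp
  · rintro w ⟨τ, h0, h1, rfl⟩
    exact hlower τ ⟨h0, h1⟩
end

section
/- Fix β > 0 and for n ≥ 1 let P_n⁻(y) = β·n·(1 − ((y − m)/(M − m))^{1/n}) for y ∈ [m, M]. Define the trading policy x* by the recursion: q₁ = 1; for t = 1, …, T − 1, after p_t is revealed set q_{t+1} = min(q_t, P⁻_{T−t}(max(p₁, …, p_t))) and sell x*_t = q_t − q_{t+1}; in the last period sell x*_T = q_T. Then this policy achieves the optimal adjustable regret guarantee: sup over price paths p of (β·max_{1 ≤ t ≤ T} p_t − Σ_{t=1}^T p_t·x*_t) = β·(M − m)·(max(0, 1 − 1/(β·T)))^T − (1 − β)·m. -/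
open scoped BigOperators

/-- `Pinv m M β n y = β·n·(1 − ((y − m)/(M − m))^(1/n))`, the inverse price function. -/
noncomputable def Pinv (m M β : ℝ) (n : ℕ) (y : ℝ) : ℝ :=
  β * n * (1 - ((y - m) / (M - m)) ^ ((1 : ℝ) / n))

/-- `maxPref p t = max(p 0, …, p t)`, the highest price among the first `t + 1` prices. -/
def maxPref (p : ℕ → ℝ) : ℕ → ℝ
  | 0 => p 0
  | t + 1 => max (maxPref p t) (p (t + 1))

/-- Remaining quantities of the optimal policy (`qSeq t` is `q_{t+1}` of the paper, with
prices `0`-indexed): `q₁ = 1` and `q_{t+1} = min(q_t, P⁻_{T−t}(max(p₁, …, p_t)))`. -/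
noncomputable def qSeq (m M β : ℝ) (T : ℕ) (p : ℕ → ℝ) : ℕ → ℝ
  | 0 => 1
  | t + 1 => min (qSeq m M β T p t) (Pinv m M β (T - (t + 1)) (maxPref p t))

/-- The amount sold in period `i + 1` (so `i` is `0`-indexed) by the optimal policy:
`x*_t = q_t − q_{t+1}` for `t < T` and `x*_T = q_T`. -/
noncomputable def amt (m M β : ℝ) (T : ℕ) (p : ℕ → ℝ) (i : ℕ) : ℝ :=
  if i + 1 = T then qSeq m M β T p i
  else qSeq m M β T p i - qSeq m M β T p (i + 1)

lemma succ_mul_mul_pow_le {a s : ℝ} (ha : 0 ≤ a) (hs : 0 ≤ s) (n : ℕ) :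
    (n + 1) * a * s ^ n ≤ a ^ (n + 1) + n * s ^ (n + 1) := by
  induction n with
  | zero => simp
  | succ n ih =>
    have h1 := mul_le_mul_of_nonneg_left ih ha
    have h2 : 0 ≤ (n + 1) * s ^ n * (a - s) ^ 2 := by positivity
    push_cast
    ring_nf at h1 h2 ⊢
    linarith

/-- The price function inverse to `Pinv`, in the normalized units where prices lie in `[0, 1]`. -/
noncomputable def normPrice (β : ℝ) (n : ℕ) (q : ℝ) : ℝ :=
  (max 0 (1 - q / (β * n))) ^ n

lemma normPrice_nonneg (β : ℝ) (n : ℕ) (q : ℝ) : 0 ≤ normPrice β n q := by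
  unfold normPrice; positivity

/-- Tangent-line bound for `normPrice β (n + 1)`. -/
lemma le_mul_normPrice_succ {β q s : ℝ} (hβ : 0 < β) (hs : 0 ≤ s) (n : ℕ) :
    s ^ n * (β * (n + 1) - q - β * n * s) ≤ β * normPrice β (n + 1) q := by
  have hpos : 0 < β * ((n : ℝ) + 1) := by positivity
  obtain ⟨a, ha⟩ : ∃ a, a = max 0 (1 - q / (β * ((n : ℝ) + 1))) := ⟨_, rfl⟩
  have ha0 : 0 ≤ a := ha ▸ le_max_left _ _
  have h1 : 1 - q / (β * ((n : ℝ) + 1)) ≤ a := ha ▸ le_max_right _ _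
  have h2 : β * (n + 1) - q ≤ β * (n + 1) * a := by
    have := mul_le_mul_of_nonneg_left h1 hpos.le
    rwa [mul_sub, mul_div_cancel₀ _ hpos.ne', mul_one] at this
  have h3 := mul_le_mul_of_nonneg_left
    (succ_mul_mul_pow_le ha0 hs n) hβ.le
  have h4 := mul_le_mul_of_nonneg_left h2 (pow_nonneg hs n)
  have h5 : normPrice β (n + 1) q = a ^ (n + 1) := by simp [normPrice, ha]
  rw [h5]
  ring_nf at h3 h4 ⊢
  linarith

lemma normPrice_le_succ {β : ℝ} (hβ : 0 < β) {n : ℕ} (hn : n ≠ 0) (q : ℝ) :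
    normPrice β n q ≤ normPrice β (n + 1) q := by
  have hpos : 0 < β * (n : ℝ) := by positivity
  rcases le_total (1 - q / (β * n)) 0 with h | h
  · rw [normPrice, max_eq_left h, zero_pow hn]
    exact normPrice_nonneg _ _ _
  · have h1 := le_mul_normPrice_succ (q := q) hβ h n
    have h2 : β * (n + 1) - q - β * n * (1 - q / (β * n)) = β := by
      rw [mul_sub, mul_div_cancel₀ _ hpos.ne']; ring
    rw [h2, mul_comm] at h1
    rw [normPrice, max_eq_right h]
    exact le_of_mul_le_mul_left h1 hβ

/-- Worst-case continuation value (divided by `β`) with `n` periods remaining, quantity `q` left,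
and normalized running maximum `Y`. -/
noncomputable def contValue (β : ℝ) (n : ℕ) (q Y : ℝ) : ℝ :=
  if n = 0 then Y else normPrice β n q

/-- The normalized inverse price function. -/
noncomputable def normInv (β : ℝ) (n : ℕ) (y : ℝ) : ℝ :=
  β * n * (1 - y ^ ((1 : ℝ) / n))

lemma normInv_nonneg {β y : ℝ} (hβ : 0 < β) (hy0 : 0 ≤ y) (hy1 : y ≤ 1) (n : ℕ) :
    0 ≤ normInv β n y := by
  have : y ^ ((1 : ℝ) / n) ≤ 1 := Real.rpow_le_one hy0 hy1 (by positivity)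
  unfold normInv
  have : 0 ≤ 1 - y ^ ((1 : ℝ) / n) := by linarith
  positivity

lemma one_sub_normInv_div {β : ℝ} (hβ : 0 < β) {n : ℕ} (hn : n ≠ 0) (y : ℝ) :
    1 - normInv β n y / (β * n) = y ^ ((1 : ℝ) / n) := by
  have hpos : 0 < β * (n : ℝ) := by positivity
  rw [normInv, mul_div_cancel_left₀ _ hpos.ne']; ring

lemma rpow_one_div_pow {y : ℝ} (hy : 0 ≤ y) {n : ℕ} (hn : n ≠ 0) :
    (y ^ ((1 : ℝ) / n)) ^ n = y := by
  rw [one_div]; exact Real.rpow_inv_natCast_pow hy hn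

lemma normPrice_normInv {β y : ℝ} (hβ : 0 < β) (hy : 0 ≤ y) {n : ℕ} (hn : n ≠ 0) :
    normPrice β n (normInv β n y) = y := by
  rw [normPrice, one_sub_normInv_div hβ hn, max_eq_right (Real.rpow_nonneg hy _),
    rpow_one_div_pow hy hn]

lemma normPrice_anti {β q q' : ℝ} (hβ : 0 < β) (n : ℕ) (h : q ≤ q') :
    normPrice β n q' ≤ normPrice β n q := by
  unfold normPrice
  gcongr

lemma le_contValue {β q y : ℝ} (hβ : 0 < β) (hy : 0 ≤ y) (n : ℕ) (h : q ≤ normInv β n y) :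
    y ≤ contValue β n q y := by
  unfold contValue
  split_ifs with hn
  · exact le_rfl
  · calc y = normPrice β n (normInv β n y) := (normPrice_normInv hβ hy hn).symm
      _ ≤ _ := normPrice_anti hβ n h

/-- The potential does not increase in one period of the policy. -/
lemma contValue_step {β q Y y : ℝ} (hβ : 0 < β) (hq : 0 ≤ q) (hY0 : 0 ≤ Y)
    (hy0 : 0 ≤ y) (hy1 : y ≤ 1) (n : ℕ) (hY : Y ≤ normPrice β (n + 1) q) :
    β * contValue β n (min q (normInv β n (max Y y))) (max Y y)
      - y * (q - min q (normInv β n (max Y y))) ≤ β * normPrice β (n + 1) q := by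
  have hmax : 0 ≤ max Y y := le_max_of_le_left hY0
  by_cases hA : n ≠ 0 ∧ q ≤ normInv β n (max Y y)
  · obtain ⟨hn, h⟩ := hA
    rw [min_eq_left h, contValue, if_neg hn, sub_self, mul_zero, sub_zero]
    exact mul_le_mul_of_nonneg_left (normPrice_le_succ hβ hn q) hβ.le
  · have hle : normInv β n (max Y y) ≤ q := by
      by_cases hn : n = 0
      · subst hn; simpa [normInv] using hq
      · exact le_of_not_ge fun h => hA ⟨hn, h⟩
    have hval : contValue β n (normInv β n (max Y y)) (max Y y) = max Y y := by
      unfold contValue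
      split_ifs with hn
      · rfl
      · exact normPrice_normInv hβ hmax hn
    rw [min_eq_right hle, hval]
    rcases le_total y Y with h | h
    · rw [max_eq_left h] at hle ⊢
      have h1 := mul_nonneg hy0 (sub_nonneg.2 hle)
      have h2 := mul_le_mul_of_nonneg_left hY hβ.le
      linarith
    · rw [max_eq_right h]
      by_cases hn : n = 0
      · subst hn
        have h1 := le_mul_normPrice_succ (q := q) hβ hy0 0
        have h2 := normPrice_nonneg β (0 + 1) q
        simp only [normInv, Nat.cast_zero, mul_zero, zero_mul, pow_zero, zero_add, one_mul,
          sub_zero, mul_one] at h1 h2 ⊢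
        nlinarith [mul_le_mul_of_nonneg_left h1 hy0,
          mul_le_mul_of_nonneg_right hy1 (mul_nonneg hβ.le h2)]
      · have h1 := le_mul_normPrice_succ (q := q) hβ (Real.rpow_nonneg hy0 ((1 : ℝ) / n)) n
        rw [rpow_one_div_pow hy0 hn] at h1
        unfold normInv
        linarith

/-- Normalized running maximum of the first `t` prices, equal to `0` before any price is seen. -/
noncomputable def normMax (m M : ℝ) (p : ℕ → ℝ) : ℕ → ℝ
  | 0 => 0
  | t + 1 => (maxPref p t - m) / (M - m)

section Path

variable {m M β : ℝ} {T : ℕ} {p : ℕ → ℝ}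

lemma normalized_mem (hmM : m < M) {x : ℝ} (hx : x ∈ Set.Icc m M) :
    0 ≤ (x - m) / (M - m) ∧ (x - m) / (M - m) ≤ 1 := by
  have hD : 0 < M - m := sub_pos.2 hmM
  exact ⟨div_nonneg (by linarith [hx.1]) hD.le, (div_le_one hD).2 (by linarith [hx.2])⟩

lemma maxPref_mem (hp : ∀ i < T, p i ∈ Set.Icc m M) {t : ℕ} (ht : t < T) :
    maxPref p t ∈ Set.Icc m M := by
  induction t with
  | zero => exact hp 0 ht
  | succ t ih =>
    have h1 := ih (by omega)
    have h2 := hp _ ht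
    exact ⟨le_max_of_le_left h1.1, max_le h1.2 h2.2⟩

lemma normMax_succ (hmM : m < M) (hp : ∀ i < T, p i ∈ Set.Icc m M) {t : ℕ} (ht : t < T) :
    normMax m M p (t + 1) = max (normMax m M p t) ((p t - m) / (M - m)) := by
  have hD : 0 < M - m := sub_pos.2 hmM
  cases t with
  | zero => exact (max_eq_right (normalized_mem hmM (hp 0 ht)).1).symm
  | succ t =>
    simp only [normMax, maxPref]
    rw [max_div_div_right hD.le, max_sub_sub_right]

lemma normMax_nonneg (hmM : m < M) (hp : ∀ i < T, p i ∈ Set.Icc m M) {t : ℕ} (ht : t ≤ T) :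
    0 ≤ normMax m M p t := by
  cases t with
  | zero => exact le_rfl
  | succ t => exact (normalized_mem hmM (maxPref_mem hp ht)).1

lemma qSeq_succ (t : ℕ) : qSeq m M β T p (t + 1) =
    min (qSeq m M β T p t) (normInv β (T - (t + 1)) (normMax m M p (t + 1))) := rfl

lemma qSeq_nonneg (hmM : m < M) (hβ : 0 < β) (hp : ∀ i < T, p i ∈ Set.Icc m M)
    {t : ℕ} (ht : t ≤ T) : 0 ≤ qSeq m M β T p t := by
  induction t with
  | zero => exact zero_le_one
  | succ t ih =>
    have h := normalized_mem hmM (maxPref_mem hp ht)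
    exact le_min (ih (by omega)) (normInv_nonneg hβ h.1 h.2 _)

lemma qSeq_last (hmM : m < M) (hβ : 0 < β) (hp : ∀ i < T, p i ∈ Set.Icc m M) (hT : 1 ≤ T) :
    qSeq m M β T p T = 0 := by
  obtain ⟨n, rfl⟩ : ∃ n, T = n + 1 := ⟨T - 1, by omega⟩
  rw [qSeq_succ, Nat.sub_self]
  simpa [normInv] using qSeq_nonneg hmM hβ hp (Nat.le_succ n)

lemma amt_eq (hmM : m < M) (hβ : 0 < β) (hp : ∀ i < T, p i ∈ Set.Icc m M) (hT : 1 ≤ T) (i : ℕ) :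
    amt m M β T p i = qSeq m M β T p i - qSeq m M β T p (i + 1) := by
  unfold amt
  split_ifs with h
  · rw [h, qSeq_last hmM hβ hp hT, sub_zero]
  · rfl

/-- The adjusted regret in normalized units. -/
lemma regret_eq (hmM : m < M) (hβ : 0 < β) (hp : ∀ i < T, p i ∈ Set.Icc m M) (hT : 1 ≤ T) :
    β * maxPref p (T - 1) - ∑ i ∈ Finset.range T, p i * amt m M β T p i =
      (M - m) * (β * normMax m M p T - ∑ i ∈ Finset.range T,
        (p i - m) / (M - m) * (qSeq m M β T p i - qSeq m M β T p (i + 1))) - (1 - β) * m := by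
  have hD : M - m ≠ 0 := (sub_pos.2 hmM).ne'
  have hsum : ∑ i ∈ Finset.range T, p i * amt m M β T p i =
      (M - m) * ∑ i ∈ Finset.range T,
        (p i - m) / (M - m) * (qSeq m M β T p i - qSeq m M β T p (i + 1)) + m := by
    have h1 : ∑ i ∈ Finset.range T, (qSeq m M β T p i - qSeq m M β T p (i + 1)) = 1 := by
      rw [Finset.sum_range_sub', qSeq_last hmM hβ hp hT]
      simp [qSeq]
    calc _ = ∑ i ∈ Finset.range T, ((M - m) * ((p i - m) / (M - m) *
            (qSeq m M β T p i - qSeq m M β T p (i + 1))) +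
            m * (qSeq m M β T p i - qSeq m M β T p (i + 1))) := by
          refine Finset.sum_congr rfl fun i _ => ?_
          rw [amt_eq hmM hβ hp hT]
          field_simp
          ring
      _ = _ := by rw [Finset.sum_add_distrib, ← Finset.mul_sum, ← Finset.mul_sum, h1, mul_one]
  have hmax : maxPref p (T - 1) = (M - m) * normMax m M p T + m := by
    obtain ⟨n, rfl⟩ : ∃ n, T = n + 1 := ⟨T - 1, by omega⟩
    simp only [Nat.add_sub_cancel, normMax]
    field_simp
    ring
  rw [hsum, hmax]
  ring

lemma potential_le (hmM : m < M) (hβ : 0 < β) (hp : ∀ i < T, p i ∈ Set.Icc m M) (hT : 1 ≤ T)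
    {t : ℕ} (ht : t ≤ T) :
    normMax m M p t ≤ contValue β (T - t) (qSeq m M β T p t) (normMax m M p t) ∧
    β * contValue β (T - t) (qSeq m M β T p t) (normMax m M p t) -
      ∑ i ∈ Finset.range t, (p i - m) / (M - m) *
        (qSeq m M β T p i - qSeq m M β T p (i + 1)) ≤ β * normPrice β T 1 := by
  induction t with
  | zero =>
    have hT0 : T ≠ 0 := by omega
    simp [contValue, hT0, normMax, qSeq, normPrice_nonneg]
  | succ t ih =>
    obtain ⟨h1, h2⟩ := ih (by omega)
    refine ⟨le_contValue hβ (normMax_nonneg hmM hp ht) _ (min_le_right _ _), ?_⟩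
    obtain ⟨n, hn⟩ : ∃ n, T - t = n + 1 := ⟨T - t - 1, by omega⟩
    have hn' : T - (t + 1) = n := by omega
    rw [hn, contValue, if_neg n.succ_ne_zero] at h1 h2
    have hy := normalized_mem hmM (hp t ht)
    have h3 := contValue_step hβ (qSeq_nonneg hmM hβ hp (Nat.le_of_succ_le ht))
      (normMax_nonneg hmM hp (Nat.le_of_succ_le ht)) hy.1 hy.2 n h1
    rw [← normMax_succ hmM hp ht, ← hn', ← qSeq_succ] at h3
    rw [Finset.sum_range_succ]
    rw [hn'] at h3 ⊢
    linarith

lemma regret_le (hmM : m < M) (hβ : 0 < β) (hp : ∀ i < T, p i ∈ Set.Icc m M) (hT : 1 ≤ T) :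
    β * normMax m M p T - ∑ i ∈ Finset.range T,
      (p i - m) / (M - m) * (qSeq m M β T p i - qSeq m M β T p (i + 1)) ≤
      β * normPrice β T 1 := by
  have h := (potential_le hmM hβ hp hT le_rfl).2
  simpa [contValue] using h

end Path

lemma maxPref_eq_of_le_succ {p : ℕ → ℝ} {T : ℕ} (hp : ∀ i, i + 1 < T → p i ≤ p (i + 1)) {t : ℕ}
    (ht : t < T) : maxPref p t = p t := by
  induction t with
  | zero => rfl
  | succ t ih => rw [maxPref, ih (by omega), max_eq_right (hp t ht)]

/-- A price path attaining the bound. -/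
lemma exists_regret_eq {m M β : ℝ} {T : ℕ} (hmM : m < M) (hβ : 0 < β) (hT : 1 ≤ T) :
    ∃ p : ℕ → ℝ, (∀ i < T, p i ∈ Set.Icc m M) ∧
      β * normMax m M p T - ∑ i ∈ Finset.range T,
        (p i - m) / (M - m) * (qSeq m M β T p i - qSeq m M β T p (i + 1)) =
        β * normPrice β T 1 := by
  have hD : 0 < M - m := sub_pos.2 hmM
  have hT0 : T ≠ 0 := by omega
  have hTpos : (0 : ℝ) < T := by positivity
  rcases le_or_gt (1 - 1 / (β * T)) 0 with ha | ha
  · refine ⟨fun _ => m, fun i _ => ⟨le_rfl, hmM.le⟩, ?_⟩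
    obtain ⟨n, rfl⟩ : ∃ n, T = n + 1 := ⟨T - 1, by omega⟩
    rw [normPrice, max_eq_left ha, zero_pow hT0, normMax,
      maxPref_eq_of_le_succ (T := n + 1) (fun _ _ => le_rfl) n.lt_succ_self]
    simp
  · obtain ⟨a, hadef⟩ : ∃ a, a = 1 - 1 / (β * T) := ⟨_, rfl⟩
    rw [normPrice, max_eq_right ha.le]
    rw [← hadef] at ha ⊢
    have ha1 : a ≤ 1 := by
      have : 0 ≤ 1 / (β * T) := by positivity
      linarith
    have hinit : β * T * (1 - a) = 1 := by rw [hadef]; field_simp; ring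
    let p : ℕ → ℝ := fun i => m + (M - m) * a ^ (T - 1 - i)
    have hpow (k : ℕ) : a ^ k ≤ 1 := pow_le_one₀ ha.le ha1
    have hp : ∀ i < T, p i ∈ Set.Icc m M := fun i _ => by
      have h0 : 0 ≤ a ^ (T - 1 - i) := by positivity
      constructor <;> simp only [p] <;> nlinarith [hpow (T - 1 - i)]
    have hmono : ∀ i, i + 1 < T → p i ≤ p (i + 1) := fun i _ => by
      simp only [p]
      gcongr m + _ * ?_
      exact pow_le_pow_of_le_one ha.le ha1 (by omega)
    have hnorm (i : ℕ) : (p i - m) / (M - m) = a ^ (T - 1 - i) := by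
      simp only [p]; field_simp; ring
    have hmax {t : ℕ} (ht : t < T) : normMax m M p (t + 1) = a ^ (T - 1 - t) := by
      rw [normMax, maxPref_eq_of_le_succ hmono ht, hnorm]
    have hq {t : ℕ} (ht : t ≤ T) : qSeq m M β T p t = β * (T - t : ℕ) * (1 - a) := by
      induction t with
      | zero => simpa [qSeq] using hinit.symm
      | succ t ih =>
        have hP : normInv β (T - (t + 1)) (normMax m M p (t + 1)) =
            β * (T - (t + 1) : ℕ) * (1 - a) := by
          rw [hmax ht, show T - 1 - t = T - (t + 1) by omega, normInv]
          by_cases h0 : T - (t + 1) = 0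
          · simp [h0]
          · rw [one_div, Real.pow_rpow_inv_natCast ha.le h0]
        rw [qSeq_succ, hP, ih (by omega)]
        refine min_eq_right ?_
        have : 0 ≤ 1 - a := by linarith
        gcongr
        omega
    refine ⟨p, hp, ?_⟩
    have hsum : ∑ i ∈ Finset.range T,
        (p i - m) / (M - m) * (qSeq m M β T p i - qSeq m M β T p (i + 1)) =
        β * (1 - a ^ T) := by
      rw [← mul_neg_geom_sum, ← Finset.sum_range_reflect (fun i => a ^ i), Finset.mul_sum,
        Finset.mul_sum]
      refine Finset.sum_congr rfl fun i hi => ?_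
      have hi' := Finset.mem_range.1 hi
      rw [hnorm, hq hi'.le, hq hi', show T - i = T - (i + 1) + 1 by omega]
      push_cast
      ring
    have hlast : normMax m M p T = 1 := by
      obtain ⟨n, rfl⟩ : ∃ n, T = n + 1 := ⟨T - 1, by omega⟩
      rw [hmax n.lt_succ_self]; simp
    rw [hsum, hlast]
    ring

/-- The policy `x*` defined by the recursion `q₁ = 1`,
`q_{t+1} = min(q_t, P⁻_{T−t}(max(p₁, …, p_t)))`, `x*_t = q_t − q_{t+1}`, `x*_T = q_T`
achieves the optimal adjustable regret guarantee
`β·(M − m)·(max(0, 1 − 1/(β·T)))^T − (1 − β)·m`. -/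
theorem one_way_trading_optimal_policy
    (m M : ℝ) (hm : 0 < m) (hmM : m < M) (T : ℕ) (hT : 1 ≤ T) (β : ℝ) (hβ : 0 < β) :
    sSup { v : ℝ | ∃ p : ℕ → ℝ, (∀ i < T, p i ∈ Set.Icc m M) ∧
        v = β * maxPref p (T - 1) - ∑ i ∈ Finset.range T, p i * amt m M β T p i } =
      β * (M - m) * (max 0 (1 - 1 / (β * T))) ^ T - (1 - β) * m := by
  have hval : β * (M - m) * (max 0 (1 - 1 / (β * T))) ^ T - (1 - β) * m =
      (M - m) * (β * normPrice β T 1) - (1 - β) * m := by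
    rw [normPrice]; ring
  rw [hval]
  refine IsGreatest.csSup_eq ⟨?_, ?_⟩
  · obtain ⟨p, hp, h⟩ := exists_regret_eq hmM hβ hT
    exact ⟨p, hp, by rw [regret_eq hmM hβ hp hT, h]⟩
  · rintro v ⟨p, hp, rfl⟩
    rw [regret_eq hmM hβ hp hT]
    have h := mul_le_mul_of_nonneg_left (regret_le hmM hβ hp hT) (sub_pos.2 hmM).le
    linarith
end
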